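/- Let M, N₀ be positive integers with N₀ ≤ M and let 0 < q < p ≤ 1. Let (A_e) be independent Bernoulli(q) random variables indexed by the unordered pairs e = {i,j} of distinct elements of Fin M, and set t = C(N₀,2)·(p − q)/2. Then the probability that there exists a subset L ⊆ Fin M with |L| = N₀ such that the number of pairs e ⊆ L with A_e = 1 is at least C(N₀,2)·(p+q)/2 is at most C(M,N₀)·exp(−t²/(2·C(N₀,2)·q + 2t/3)), where C(a,b) denotes the binomial coefficient a choose b. -/

import Mathlib

open Finset Classical

/-- The unordered pairs of distinct elements of `Fin M`, encoded as ordered pairs `(i,j)`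
with `i < j`. -/
abbrev Edge (M : ℕ) : Type := {e : Fin M × Fin M // e.1 < e.2}

/-- The quadratic bound on the exponential behind Bernstein's inequality. -/
lemma exp_le_one_add_add_sq_div {x : ℝ} (hx : 0 ≤ x) (hx3 : x < 3) :
    Real.exp x ≤ 1 + x + x ^ 2 / 2 / (1 - x / 3) := by
  have hexp : HasSum (fun n : ℕ => x ^ n / (n.factorial : ℝ)) (Real.exp x) := by
    rw [Real.exp_eq_exp_ℝ]
    exact NormedSpace.expSeries_div_hasSum_exp x
  have htail : HasSum (fun n : ℕ => x ^ (n + 2) / ((n + 2).factorial : ℝ))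
      (Real.exp x - (1 + x)) := by
    have h := (hasSum_nat_add_iff' 2).mpr hexp
    simpa [Finset.sum_range_succ] using h
  have hgeom : HasSum (fun n : ℕ => x ^ 2 / 2 * (x / 3) ^ n) (x ^ 2 / 2 * (1 - x / 3)⁻¹) :=
    (hasSum_geometric_of_lt_one (by positivity) (by linarith)).mul_left _
  have hle := hasSum_le (fun n => ?_) htail hgeom
  · rw [div_eq_mul_inv (x ^ 2 / 2)]
    linarith
  · have hfac : (2 * 3 ^ n : ℝ) ≤ ((n + 2).factorial : ℝ) := by
      have h := Nat.factorial_mul_pow_le_factorial (m := 2) (n := n)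
      rw [add_comm 2 n] at h
      exact_mod_cast h
    calc x ^ (n + 2) / ((n + 2).factorial : ℝ) ≤ x ^ (n + 2) / (2 * 3 ^ n) := by gcongr
      _ = x ^ 2 / 2 * (x / 3) ^ n := by
        rw [div_pow, pow_add]
        field_simp

/-- The moment generating function of the number of successes inside `S`. -/
lemma sum_exp_card_mul_bernoulli {α : Type*} [Fintype α] [DecidableEq α] (S : Finset α)
    (q l : ℝ) :
    ∑ ω : α → Bool, Real.exp (l * ((S.filter (fun e => ω e = true)).card : ℝ)) *
        ∏ e, (if ω e then q else 1 - q) =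
      (1 - q + q * Real.exp l) ^ S.card := by
  have hterm (ω : α → Bool) :
      Real.exp (l * ((S.filter (fun e => ω e = true)).card : ℝ)) *
        ∏ e, (if ω e then q else 1 - q) =
      ∏ e, (if e ∈ S ∧ ω e = true then Real.exp l else 1) * (if ω e then q else 1 - q) := by
    rw [Finset.prod_mul_distrib, mul_comm l, Real.exp_nat_mul]
    congr 1
    rw [← Finset.prod_filter, Finset.prod_const]
    congr 2
    ext e
    simp
  have hswap := Finset.prod_univ_sum (fun _ : α => (Finset.univ : Finset Bool))
    (fun e b => (if e ∈ S ∧ b = true then Real.exp l else 1) * (if b then q else 1 - q))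
  rw [Fintype.piFinset_univ] at hswap
  rw [Finset.sum_congr rfl fun ω _ => hterm ω, ← hswap]
  have hfactor (e : α) : ∑ b : Bool, (if e ∈ S ∧ b = true then Real.exp l else 1) *
      (if b then q else 1 - q) = if e ∈ S then 1 - q + q * Real.exp l else 1 := by
    by_cases he : e ∈ S <;> (simp [he]; try ring)
  rw [Finset.prod_congr rfl fun e _ => hfactor e]
  simp [Finset.prod_ite_mem]

lemma bernoulli_weight_nonneg {α : Type*} [Fintype α] {q : ℝ} (hq0 : 0 ≤ q) (hq1 : q ≤ 1)
    (ω : α → Bool) : 0 ≤ ∏ e, (if ω e then q else 1 - q) :=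
  Finset.prod_nonneg fun e _ => by split_ifs <;> linarith

/-- Chernoff's bound for the number of successes inside `S`. -/
lemma bernoulli_tail_le_exp {α : Type*} [Fintype α] [DecidableEq α] (S : Finset α) {q l : ℝ} (c : ℝ)
    (hq0 : 0 ≤ q) (hq1 : q ≤ 1) (hl : 0 ≤ l) :
    (∑ ω : α → Bool, if c ≤ ((S.filter (fun e => ω e = true)).card : ℝ)
        then ∏ e, (if ω e then q else 1 - q) else 0) ≤
      Real.exp (S.card * (q * (Real.exp l - 1)) - l * c) := by
  calc
    _ ≤ ∑ ω : α → Bool, Real.exp (-(l * c)) *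
        (Real.exp (l * ((S.filter (fun e => ω e = true)).card : ℝ)) *
          ∏ e, (if ω e then q else 1 - q)) := by
      refine Finset.sum_le_sum fun ω _ => ?_
      have hw := bernoulli_weight_nonneg hq0 hq1 ω
      split_ifs with h
      · rw [← mul_assoc, ← Real.exp_add]
        refine le_mul_of_one_le_left hw (Real.one_le_exp ?_)
        nlinarith [mul_le_mul_of_nonneg_left h hl]
      · positivity
    _ = Real.exp (-(l * c)) * (1 - q + q * Real.exp l) ^ S.card := by
      rw [← Finset.mul_sum, sum_exp_card_mul_bernoulli]
    _ ≤ Real.exp (-(l * c)) * Real.exp (q * (Real.exp l - 1)) ^ S.card := by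
      have hbase : 0 ≤ 1 - q + q * Real.exp l :=
        add_nonneg (by linarith) (mul_nonneg hq0 (Real.exp_nonneg l))
      gcongr
      linarith [Real.add_one_le_exp (q * (Real.exp l - 1))]
    _ = _ := by
      rw [← Real.exp_nat_mul, ← Real.exp_add]
      congr 1
      ring

/-- Bernstein's inequality for the number of successes inside `S`. -/
lemma bernoulli_tail_le_bernstein {α : Type*} [Fintype α] [DecidableEq α] (S : Finset α) {q d : ℝ}
    (hq0 : 0 < q) (hq1 : q ≤ 1) (hd : 0 ≤ d) :
    (∑ ω : α → Bool, if (S.card : ℝ) * (q + d) ≤ ((S.filter (fun e => ω e = true)).card : ℝ)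
        then ∏ e, (if ω e then q else 1 - q) else 0) ≤
      Real.exp (-(S.card * d ^ 2 / (2 * (q + d / 3)))) := by
  have hs : 0 < q + d / 3 := by positivity
  have hl : 0 ≤ d / (q + d / 3) := by positivity
  have hl3 : d / (q + d / 3) < 3 := by
    rw [div_lt_iff₀ hs]
    linarith
  refine (bernoulli_tail_le_exp S _ hq0.le hq1 hl).trans (Real.exp_le_exp.mpr ?_)
  have hexp := exp_le_one_add_add_sq_div hl hl3
  have hquot : q * ((d / (q + d / 3)) ^ 2 / 2 / (1 - d / (q + d / 3) / 3)) =
      d ^ 2 / (2 * (q + d / 3)) := by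
    have h1 : 1 - d / (q + d / 3) / 3 = q / (q + d / 3) := by
      field_simp
      ring
    rw [h1]
    field_simp
  have hopt : d / (q + d / 3) * d = 2 * (d ^ 2 / (2 * (q + d / 3))) := by
    field_simp
  have hrate : q * (Real.exp (d / (q + d / 3)) - 1) - d / (q + d / 3) * (q + d) ≤
      -(d ^ 2 / (2 * (q + d / 3))) := by
    nlinarith [mul_le_mul_of_nonneg_left hexp hq0.le]
  have := mul_le_mul_of_nonneg_left hrate (Nat.cast_nonneg (α := ℝ) S.card)
  rw [mul_div_assoc]
  linarith

lemma card_edges_within {M : ℕ} (L : Finset (Fin M)) :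
    (Finset.univ.filter (fun e : Edge M => e.val.1 ∈ L ∧ e.val.2 ∈ L)).card =
      L.card.choose 2 := by
  rw [← Finset.card_powersetCard]
  refine Finset.card_bij (fun e _ => {e.val.1, e.val.2}) ?_ ?_ ?_
  · rintro ⟨⟨i, j⟩, hij⟩ h
    simp only [Finset.mem_filter, Finset.mem_univ, true_and] at h
    simp only [Finset.mem_powersetCard]
    exact ⟨by simp [Finset.insert_subset_iff, h], Finset.card_pair (ne_of_lt hij)⟩
  · rintro ⟨⟨i, j⟩, hij⟩ _ ⟨⟨k, l⟩, hkl⟩ _ h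
    simp only [Finset.ext_iff, Finset.mem_insert, Finset.mem_singleton] at h
    have hi := h i
    have hj := h j
    have hk := h k
    have hl := h l
    simp only [Subtype.mk.injEq, Prod.mk.injEq]
    dsimp only at hij hkl
    grind
  · intro s hs
    obtain ⟨hsL, hcard⟩ := Finset.mem_powersetCard.mp hs
    obtain ⟨x, y, hxy, rfl⟩ := Finset.card_eq_two.mp hcard
    have hx : x ∈ L := hsL (by simp)
    have hy : y ∈ L := hsL (by simp)
    rcases lt_or_gt_of_ne hxy with h | h
    · exact ⟨⟨(x, y), h⟩, by simp [hx, hy], rfl⟩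
    · exact ⟨⟨(y, x), h⟩, by simp [hx, hy], Finset.pair_comm y x⟩

/-- Scan-test Type-I error bound (Bernstein form): for independent `Bernoulli(q)` edge labels
on the unordered pairs of `Fin M`, with `t = C(N₀,2)·(p−q)/2`, the probability that some
`N₀`-element subset `L` contains at least `C(N₀,2)·(p+q)/2` present edges is at most
`C(M,N₀)·exp(−t²/(2·C(N₀,2)·q + 2t/3))`. The probability is written as the sum, over all
edge labelings `ω`, of the product Bernoulli weight of `ω` restricted to labelings realizing
the event. -/
theorem scan_test_type_one_bernstein (M N₀ : ℕ) (hN₀ : 0 < N₀) (hNM : N₀ ≤ M)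
    (p q : ℝ) (hq0 : 0 < q) (hqp : q < p) (hp1 : p ≤ 1) :
    (∑ ω : Edge M → Bool,
      if (∃ L ∈ Finset.powersetCard N₀ (Finset.univ : Finset (Fin M)),
            (N₀.choose 2 : ℝ) * ((p + q) / 2) ≤
              ((Finset.univ.filter (fun e : Edge M =>
                  e.val.1 ∈ L ∧ e.val.2 ∈ L ∧ ω e = true)).card : ℝ))
      then ∏ e : Edge M, (if ω e then q else 1 - q)
      else 0)
      ≤ (M.choose N₀ : ℝ) *
          Real.exp (-(((N₀.choose 2 : ℝ) * (p - q) / 2) ^ 2 /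
            (2 * (N₀.choose 2 : ℝ) * q + 2 * ((N₀.choose 2 : ℝ) * (p - q) / 2) / 3))) := by
  calc
    _ ≤ ∑ ω : Edge M → Bool, ∑ L ∈ Finset.powersetCard N₀ (Finset.univ : Finset (Fin M)),
        if (N₀.choose 2 : ℝ) * ((p + q) / 2) ≤
            ((Finset.univ.filter (fun e : Edge M =>
              e.val.1 ∈ L ∧ e.val.2 ∈ L ∧ ω e = true)).card : ℝ)
        then ∏ e : Edge M, (if ω e then q else 1 - q) else 0 := by
      refine Finset.sum_le_sum fun ω _ => ?_
      have hw := bernoulli_weight_nonneg hq0.le (hqp.le.trans hp1) ω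
      have hterm (L : Finset (Fin M)) :
          0 ≤ if (N₀.choose 2 : ℝ) * ((p + q) / 2) ≤
              ((Finset.univ.filter (fun e : Edge M =>
                e.val.1 ∈ L ∧ e.val.2 ∈ L ∧ ω e = true)).card : ℝ)
          then ∏ e : Edge M, (if ω e then q else 1 - q) else 0 := by
        split_ifs
        exacts [hw, le_rfl]
      split_ifs with h
      · obtain ⟨L, hL, hcard⟩ := h
        refine le_trans ?_ (Finset.single_le_sum (fun K _ => hterm K) hL)
        rw [if_pos hcard]
      · exact Finset.sum_nonneg fun L _ => hterm L
    _ = ∑ L ∈ Finset.powersetCard N₀ (Finset.univ : Finset (Fin M)), ∑ ω : Edge M → Bool,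
        if (N₀.choose 2 : ℝ) * ((p + q) / 2) ≤
            ((Finset.univ.filter (fun e : Edge M =>
              e.val.1 ∈ L ∧ e.val.2 ∈ L ∧ ω e = true)).card : ℝ)
        then ∏ e : Edge M, (if ω e then q else 1 - q) else 0 := Finset.sum_comm
    _ ≤ ∑ L ∈ Finset.powersetCard N₀ (Finset.univ : Finset (Fin M)),
        Real.exp (-(((N₀.choose 2 : ℝ) * (p - q) / 2) ^ 2 /
          (2 * (N₀.choose 2 : ℝ) * q + 2 * ((N₀.choose 2 : ℝ) * (p - q) / 2) / 3))) := by
      refine Finset.sum_le_sum fun L hL => ?_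
      have hbern := bernoulli_tail_le_bernstein
        (Finset.univ.filter (fun e : Edge M => e.val.1 ∈ L ∧ e.val.2 ∈ L)) hq0
        (hqp.le.trans hp1) (d := (p - q) / 2) (by linarith)
      rw [card_edges_within, (Finset.mem_powersetCard.mp hL).2] at hbern
      simp only [Finset.filter_filter, and_assoc] at hbern
      have hmid : q + (p - q) / 2 = (p + q) / 2 := by ring
      rw [hmid] at hbern
      have hrate : ((N₀.choose 2 : ℝ) * (p - q) / 2) ^ 2 /
          (2 * (N₀.choose 2 : ℝ) * q + 2 * ((N₀.choose 2 : ℝ) * (p - q) / 2) / 3) =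
          N₀.choose 2 * ((p - q) / 2) ^ 2 / (2 * (q + (p - q) / 2 / 3)) := by
        rcases eq_or_ne (N₀.choose 2 : ℝ) 0 with h0 | h0
        · simp [h0]
        · have hden : 2 * (N₀.choose 2 : ℝ) * q + 2 * ((N₀.choose 2 : ℝ) * (p - q) / 2) / 3 =
              N₀.choose 2 * (2 * (q + (p - q) / 2 / 3)) := by ring
          rw [hden, mul_div_assoc, mul_pow, pow_two (N₀.choose 2 : ℝ), mul_assoc,
            mul_div_mul_left _ _ h0]
      rw [hrate]
      exact hbern
    _ = _ := by simp
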